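/- Let α, β > −1 be real. With r = 2, for each n ≥ 1 let x_{1,n}, …, x_{n,n} ∈ (0,1) be the n zeros of p_n(x; α, β). Then for every continuous function f : [0,1] → ℝ, lim_{n→∞} (1/n) ∑_{j=1}^{n} f(x_{j,n}) = ∫_0^1 f(x) u_2(x) dx, where u_2(x) = (√3/(2π)) · [ (1+√(1−x^2))^{1/3} + (1−√(1−x^2))^{1/3} ] / ( x^{1/3} √(1−x^2) ) for 0 < x < 1. In particular, the asymptotic zero distribution is independent of α and β. -/

import Mathlib

/-- The polynomial p_n(x; α, β), here used with r = 2. -/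
noncomputable def jacAng (r n : ℕ) (α β x : ℝ) : ℝ :=
  ∑ k ∈ Finset.range (n + 1), (n.choose k : ℝ) *
    (Real.Gamma (n + α + (β + k) / r + 1) /
      (Real.Gamma (n + α + 1) * Real.Gamma ((β + k) / r + 1))) *
    (-1) ^ (n - k) * x ^ k

/-- The limiting density u_2 on (0,1). -/
noncomputable def u2 (x : ℝ) : ℝ :=
  (Real.sqrt 3 / (2 * Real.pi)) *
    (((1 + Real.sqrt (1 - x ^ 2)) ^ ((1:ℝ)/3) + (1 - Real.sqrt (1 - x ^ 2)) ^ ((1:ℝ)/3)) /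
      (x ^ ((1:ℝ)/3) * Real.sqrt (1 - x ^ 2)))

section

open PowerSeries

/-- The Euler operator `X * d/dX` on formal power series. -/
noncomputable def eulerOp : Derivation ℝ ℝ⟦X⟧ ℝ⟦X⟧ :=
  (X : ℝ⟦X⟧) • PowerSeries.derivative ℝ

theorem coeff_eulerOp (f : ℝ⟦X⟧) (m : ℕ) : coeff m (eulerOp f) = m * coeff m f := by
  have h : eulerOp f = X * PowerSeries.derivative ℝ f := rfl
  rw [h]
  cases m with
  | zero => simp
  | succ m =>
    rw [coeff_succ_X_mul]
    simp [PowerSeries.coeff_derivative, mul_comm]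

theorem eulerOp_mul (f g : ℝ⟦X⟧) : eulerOp (f * g) = f * eulerOp g + g * eulerOp f := by
  simp

theorem eulerOp_X : eulerOp X = X := by
  ext m; rw [coeff_eulerOp, coeff_X]; split_ifs with h <;> simp [h]

theorem eulerOp_C (c : ℝ) : eulerOp (C c) = 0 := by
  ext m; rw [coeff_eulerOp, coeff_C]; split_ifs with h <;> simp [h]

/-- A power series solving the cubic also solves a first-order equation. -/
theorem eulerOp_eq_of_cubic {G : ℝ⟦X⟧} (h : X ^ 2 * G ^ 3 = (1 - G) ^ 2 * (2 + G))
    (h0 : coeff 0 G = 1) :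
    3 * eulerOp G = G * (G - 1) * (G + 2) := by
  have hG : G ≠ 0 := by rintro rfl; simp at h0
  have hG1 : 1 - G ≠ 0 := by
    intro h1
    rw [h1, show G = 1 from (sub_eq_zero.mp h1).symm] at h
    simp at h
  have hd := congrArg eulerOp h
  have h1 : eulerOp (1 : ℝ⟦X⟧) = 0 := eulerOp.map_one_eq_zero
  have h2 : eulerOp (2 : ℝ⟦X⟧) = 0 := by exact_mod_cast eulerOp.map_natCast 2
  simp only [pow_succ, pow_zero, one_mul, eulerOp_mul, map_add, map_sub, eulerOp_X, h1, h2] at hd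
  have h6 : (2 : ℝ⟦X⟧) * (1 - G) ≠ 0 := by
    refine mul_ne_zero (fun e => ?_) hG1
    have e' := congrArg (constantCoeff (R := ℝ)) e
    rw [map_ofNat, map_zero] at e'
    norm_num at e'
  apply mul_left_cancel₀ h6
  linear_combination G * hd - (3 * eulerOp G + 2 * G) * h

theorem eulerOp_linear_of_cubic {G : ℝ⟦X⟧} (h : X ^ 2 * G ^ 3 = (1 - G) ^ 2 * (2 + G))
    (h0 : coeff 0 G = 1) :
    9 * (eulerOp (eulerOp G) - eulerOp G) =
      X ^ 2 * (9 * eulerOp (eulerOp G) + 18 * eulerOp G + 8 * G) := by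
  have hP := eulerOp_eq_of_cubic h h0
  have hd := congrArg eulerOp hP
  have h1 : eulerOp (1 : ℝ⟦X⟧) = 0 := eulerOp.map_one_eq_zero
  have h2 : eulerOp (2 : ℝ⟦X⟧) = 0 := by exact_mod_cast eulerOp.map_natCast 2
  have h3 : eulerOp (3 : ℝ⟦X⟧) = 0 := by exact_mod_cast eulerOp.map_natCast 3
  simp only [eulerOp_mul, map_add, map_sub, h1, h2, h3] at hd
  linear_combination (3 - 3 * X ^ 2) * hd +
    ((1 - X ^ 2) * (3 * G ^ 2 + 2 * G - 2) - 3 - 6 * X ^ 2) * hP - G * (3 * G + 5) * h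

theorem coeff_recurrence_of_cubic {G : ℝ⟦X⟧} (h : X ^ 2 * G ^ 3 = (1 - G) ^ 2 * (2 + G))
    (h0 : coeff 0 G = 1) (m : ℕ) :
    9 * ((m + 2 : ℝ) * (m + 1)) * coeff (m + 2) G =
      (9 * (m : ℝ) ^ 2 + 18 * m + 8) * coeff m G := by
  have hl := congrArg (coeff (m + 2)) (eulerOp_linear_of_cubic h h0)
  have e : ∀ (k : ℕ) (F : ℝ⟦X⟧) (j : ℕ), coeff j ((k : ℝ⟦X⟧) * F) = k * coeff j F := by
    intro k F j
    rw [← map_natCast (C (R := ℝ)) k, coeff_C_mul]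
  have e9 := e 9; have e18 := e 18; have e8 := e 8
  push_cast at e9 e18 e8
  rw [coeff_X_pow_mul] at hl
  simp only [map_add, map_sub, e9, e18, e8, coeff_eulerOp] at hl
  push_cast at hl
  linear_combination hl

theorem coeff_one_of_cubic {G : ℝ⟦X⟧} (h : X ^ 2 * G ^ 3 = (1 - G) ^ 2 * (2 + G))
    (h0 : coeff 0 G = 1) (hpos : 0 ≤ coeff 1 G) : coeff 1 G = 1 / √3 := by
  obtain ⟨H, hH⟩ : X ∣ G - 1 := X_dvd_iff.mpr (by simpa [sub_eq_zero] using h0)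
  have hG : G = 1 + X * H := by rw [← hH]; ring
  have h1 : coeff 1 G = constantCoeff H := by
    have h2 : coeff 1 (X * H) = coeff 0 H := coeff_succ_X_mul 0 H
    simp [hG, coeff_one, h2]
  have hc : G ^ 3 = H ^ 2 * (2 + G) := by
    apply mul_left_cancel₀ (pow_ne_zero 2 (X_ne_zero (R := ℝ)))
    rw [h, hG]; ring
  have hc0 := congrArg (constantCoeff (R := ℝ)) hc
  rw [coeff_zero_eq_constantCoeff] at h0
  have h2 : constantCoeff (2 : ℝ⟦X⟧) = 2 := map_ofNat _ 2
  simp only [map_pow, map_mul, map_add, h0, h2] at hc0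
  rw [h1] at hpos ⊢
  rw [eq_div_iff (by positivity)]
  have : 0 ≤ constantCoeff H * √3 := by positivity
  nlinarith [Real.sq_sqrt (show (0:ℝ) ≤ 3 by norm_num)]

/-- The coefficients of the polynomial `jacAng 2 n α β`. -/
noncomputable def jacCoeff (n : ℕ) (α β : ℝ) (k : ℕ) : ℝ :=
  (n.choose k : ℝ) *
    (Real.Gamma (n + α + (β + k) / 2 + 1) /
      (Real.Gamma (n + α + 1) * Real.Gamma ((β + k) / 2 + 1))) * (-1) ^ (n - k)

theorem jacAng_two_eq (n : ℕ) (α β t : ℝ) :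
    jacAng 2 n α β t = ∑ k ∈ Finset.range (n + 1), jacCoeff n α β k * t ^ k := by
  simp [jacAng, jacCoeff]

theorem jacCoeff_self_ne_zero {n : ℕ} (hn : 1 ≤ n) {α β : ℝ} (hα : -1 < α) (hβ : -1 < β) :
    jacCoeff n α β n ≠ 0 := by
  have hn' : (1 : ℝ) ≤ n := by exact_mod_cast hn
  have h1 := Real.Gamma_pos_of_pos (show 0 < n + α + (β + n) / 2 + 1 by linarith)
  have h2 := Real.Gamma_pos_of_pos (show 0 < n + α + 1 by linarith)
  have h3 := Real.Gamma_pos_of_pos (show 0 < (β + n) / 2 + 1 by linarith)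
  simp only [jacCoeff, Nat.choose_self, Nat.sub_self]
  positivity

theorem choose_add_two_mul (n k : ℕ) (hk : k + 2 ≤ n) :
    (n.choose (k + 2) : ℝ) * ((k + 1) * (k + 2)) = n.choose k * ((n - k) * (n - k - 1)) := by
  have h1 : (n.choose (k + 1) : ℝ) * (k + 1) = n.choose k * (n - k) := by
    have := congrArg (Nat.cast (R := ℝ)) (Nat.choose_succ_right_eq n k)
    push_cast [Nat.cast_sub (show k ≤ n by lia)] at this
    exact this
  have h2 : (n.choose (k + 2) : ℝ) * (k + 2) = n.choose (k + 1) * (n - k - 1) := by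
    have := congrArg (Nat.cast (R := ℝ)) (Nat.choose_succ_right_eq n (k + 1))
    push_cast [Nat.cast_sub (show k + 1 ≤ n by lia)] at this
    linear_combination this
  linear_combination (k + 1 : ℝ) * h2 + (n - k - 1 : ℝ) * h1

theorem jacCoeff_recurrence {n k : ℕ} (hk : k + 2 ≤ n) {α β : ℝ} (hα : -1 < α) (hβ : -1 < β) :
    jacCoeff n α β (k + 2) * ((k + 1) * (k + 2) * (β + k + 2)) =
      (n - k) * (n - k - 1) * (2 * (n + α + 1) + β + k) * jacCoeff n α β k := by
  have hn' : ((k : ℝ) + 2) ≤ n := by exact_mod_cast hk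
  have hk0 : (0 : ℝ) ≤ k := k.cast_nonneg
  have p1 : 0 < n + α + (β + k) / 2 + 1 := by linarith
  have p3 : 0 < (β + k) / 2 + 1 := by linarith
  have h1 := Real.Gamma_add_one p1.ne'
  have h3 := Real.Gamma_add_one p3.ne'
  have g2 := Real.Gamma_pos_of_pos (show 0 < n + α + 1 by linarith)
  have g3 := Real.Gamma_pos_of_pos p3
  have hs : (-1 : ℝ) ^ (n - k) = (-1) ^ (n - (k + 2)) := by
    rw [show n - k = n - (k + 2) + 2 by lia, pow_add]; norm_num
  have hc := choose_add_two_mul n k hk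
  simp only [jacCoeff]
  push_cast
  rw [show n + α + (β + (k + 2)) / 2 + 1 = n + α + (β + k) / 2 + 1 + 1 by ring,
    show (β + ((k : ℝ) + 2)) / 2 + 1 = (β + k) / 2 + 1 + 1 by ring, h1, h3, hs]
  have p3' : β + k + 2 ≠ 0 := by linarith
  generalize Real.Gamma (n + α + (β + k) / 2 + 1) = A
  generalize Real.Gamma (n + α + 1) = B at g2 ⊢
  generalize Real.Gamma ((β + k) / 2 + 1) = D at g3 ⊢
  rw [show (β + (k : ℝ)) / 2 + 1 = (β + k + 2) / 2 by ring]
  field_simp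
  linear_combination A * (2 * (n + α + 1) + β + k) * hc

/-- The series `∑ k ≤ n, c (n - k) X ^ k`, the reversal of the polynomial with coefficients `c`. -/
noncomputable def reversedSeries (n : ℕ) (c : ℕ → ℝ) : ℝ⟦X⟧ :=
  mk fun k => if k ≤ n then c (n - k) else 0

theorem reversedSeries_eq_prod {n : ℕ} {c : ℕ → ℝ} {x : Fin n → ℝ} (hx0 : ∀ j, x j ≠ 0)
    (hinj : Function.Injective x)
    (hz : ∀ j, ∑ k ∈ Finset.range (n + 1), c k * x j ^ k = 0) :
    reversedSeries n c = C (c n) * ∏ j, (1 - C (x j) * X) := by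
  set P : Polynomial ℝ := ∑ k ∈ Finset.range (n + 1), Polynomial.monomial k (c (n - k)) with hP
  set R : Polynomial ℝ :=
    Polynomial.C (c n) * ∏ j, (1 - Polynomial.C (x j) * Polynomial.X) with hR
  have hPR : P = R := by
    set s : Finset ℝ := insert 0 (Finset.univ.image fun j => (x j)⁻¹) with hs
    have hcard : s.card = n + 1 := by
      rw [hs, Finset.card_insert_of_notMem, Finset.card_image_of_injective]
      · simp
      · exact inv_injective.comp hinj
      · simpa using hx0
    refine Polynomial.eq_of_degrees_lt_of_eval_finset_eq s ?_ ?_ ?_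
    · rw [hcard]
      refine lt_of_le_of_lt Polynomial.degree_le_natDegree ?_
      exact_mod_cast Nat.lt_succ_of_le (Polynomial.natDegree_sum_le_of_forall_le _ _ fun k hk =>
        (Polynomial.natDegree_monomial_le _).trans (Finset.mem_range_succ_iff.mp hk))
    · rw [hcard]
      refine lt_of_le_of_lt Polynomial.degree_le_natDegree ?_
      have hR' : R.natDegree ≤ n := by
        have h1 : ∀ j ∈ Finset.univ, (1 - Polynomial.C (x j) * Polynomial.X).natDegree ≤ 1 :=
          fun j _ => by compute_degree
        refine (Polynomial.natDegree_C_mul_le _ _).trans ((Polynomial.natDegree_prod_le _ _).trans ?_)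
        simpa using Finset.sum_le_card_nsmul _ _ _ h1
      exact_mod_cast Nat.lt_succ_of_le hR'
    · intro t ht
      rcases Finset.mem_insert.mp ht with rfl | ht
      · simp [hP, hR, Polynomial.eval_finsetSum, Polynomial.eval_prod, Finset.sum_range_succ']
      · obtain ⟨j, -, rfl⟩ := Finset.mem_image.mp ht
        have hr : R.eval (x j)⁻¹ = 0 := by
          rw [hR, Polynomial.eval_mul, Polynomial.eval_prod,
            Finset.prod_eq_zero (Finset.mem_univ j) (by simp [hx0 j]), mul_zero]
        rw [hr, ← mul_zero ((x j)⁻¹ ^ n), ← hz j, hP, Polynomial.eval_finsetSum, Finset.mul_sum,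
          ← Finset.sum_range_reflect]
        refine Finset.sum_congr rfl fun k hk => ?_
        have hk' := Finset.mem_range_succ_iff.mp hk
        obtain ⟨l, rfl⟩ := Nat.exists_eq_add_of_le hk'
        simp only [Polynomial.eval_monomial, show k + l + 1 - 1 - k = l by lia,
          show k + l - l = k by lia]
        rw [pow_add, inv_pow, inv_pow]
        have := hx0 j
        field_simp
  have h1 : (P : ℝ⟦X⟧) = reversedSeries n c := by
    ext k
    simp only [hP, Polynomial.coeff_coe, Polynomial.finsetSum_coeff, Polynomial.coeff_monomial,
      reversedSeries, coeff_mk, Finset.sum_ite_eq', Finset.mem_range, Nat.lt_succ_iff]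
  have h2 : (R : ℝ⟦X⟧) = C (c n) * ∏ j, (1 - C (x j) * X) := by
    rw [hR, ← Polynomial.coeToPowerSeries.ringHom_apply, map_mul, map_prod]
    simp
  rw [← h1, hPR, h2]

theorem eulerOp_prod_one_sub {ι : Type*} (s : Finset ι) (x : ι → ℝ) :
    eulerOp (∏ j ∈ s, (1 - C (x j) * X)) =
      (∑ j ∈ s, (1 - mk fun m => x j ^ m)) * ∏ j ∈ s, (1 - C (x j) * X) := by
  classical
  have hone : eulerOp (1 : ℝ⟦X⟧) = 0 := eulerOp.map_one_eq_zero
  induction s using Finset.induction_on with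
  | empty => simp
  | insert i s hi ih =>
    rw [Finset.prod_insert hi, Finset.sum_insert hi, eulerOp_mul, ih, map_sub, eulerOp_mul,
      eulerOp_X, eulerOp_C, hone]
    have hgeom : (mk fun m => x i ^ m) * (1 - C (x i) * X) = 1 := by
      ext m
      rw [mul_sub, mul_one, mul_left_comm, map_sub, coeff_C_mul, coeff_mk, coeff_one]
      cases m with
      | zero => simp
      | succ m => rw [coeff_succ_mul_X, coeff_mk]; simp [pow_succ']
    linear_combination (∏ j ∈ s, (1 - C (x j) * X)) * hgeom

theorem reversedSeries_jacCoeff_ode (n : ℕ) {α β : ℝ} (hα : -1 < α) (hβ : -1 < β) {Q : ℝ⟦X⟧}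
    (hQ : Q = reversedSeries n (jacCoeff n α β)) :
    X ^ 2 * (C (n * (n - 1) * (n + β)) * Q - C (n * (n - 1) + (2 * n - 1) * (n + β)) * eulerOp Q
        + C (3 * n - 1 + β) * eulerOp (eulerOp Q) - eulerOp (eulerOp (eulerOp Q))) =
      - eulerOp (eulerOp (eulerOp Q)) + C (3 * n + 2 * α + 3 + β) * eulerOp (eulerOp Q)
        - C (3 * n + 2 * α + 2 + β) * eulerOp Q := by
  generalize ha0 : (n : ℝ) * (n - 1) * (n + β) = a0
  generalize ha1 : (n : ℝ) * (n - 1) + (2 * n - 1) * (n + β) = a1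
  generalize ha2 : 3 * (n : ℝ) - 1 + β = a2
  generalize hb2 : 3 * (n : ℝ) + 2 * α + 3 + β = b2
  generalize hb1 : 3 * (n : ℝ) + 2 * α + 2 + β = b1
  ext m
  rw [coeff_X_pow_mul']
  simp only [map_sub, map_add, map_neg, coeff_C_mul, coeff_eulerOp]
  rw [← ha0, ← ha1, ← ha2, ← hb1, ← hb2]
  clear ha0 ha1 ha2 hb1 hb2
  match m with
  | 0 => simp
  | 1 => simp only [if_neg (show ¬ 2 ≤ 1 by lia)]; push_cast; ring
  | k + 2 =>
    simp only [Nat.add_sub_cancel, if_pos (show 2 ≤ k + 2 by lia), hQ, reversedSeries, coeff_mk]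
    by_cases h : k + 2 ≤ n
    · obtain ⟨l, rfl⟩ : ∃ l, n = k + 2 + l := Nat.exists_eq_add_of_le h
      have hr := jacCoeff_recurrence (n := k + 2 + l) (k := l) (by lia) hα hβ
      rw [if_pos h, if_pos (by lia), show k + 2 + l - k = l + 2 by lia,
        show k + 2 + l - (k + 2) = l by lia]
      push_cast at hr ⊢
      linear_combination hr
    · rw [if_neg h]
      split_ifs with h'
      · have : n = k ∨ n = k + 1 := by lia
        rcases this with rfl | rfl <;> (push_cast; ring)
      · simp

/-- The logarithmic derivative of a solution of the differential equation satisfies a perturbation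
of the cubic. -/
theorem log_derivative_equation {n : ℕ} (hn : 1 ≤ n) {α β : ℝ} {Q U : ℝ⟦X⟧} (hQ0 : Q ≠ 0)
    (hU : eulerOp Q = C (n : ℝ) * U * Q)
    (hode : X ^ 2 * (C (n * (n - 1) * (n + β)) * Q
        - C (n * (n - 1) + (2 * n - 1) * (n + β)) * eulerOp Q
        + C (3 * n - 1 + β) * eulerOp (eulerOp Q) - eulerOp (eulerOp (eulerOp Q))) =
      - eulerOp (eulerOp (eulerOp Q)) + C (3 * n + 2 * α + 3 + β) * eulerOp (eulerOp Q)
        - C (3 * n + 2 * α + 2 + β) * eulerOp Q) {e : ℝ} (he : e = 1 / n) {D T : ℝ⟦X⟧}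
    (hD : D = U ^ 2 + C e * eulerOp U)
    (hT : T = U ^ 3 + 3 * C e * U * eulerOp U + C e ^ 2 * eulerOp (eulerOp U)) :
    X ^ 2 * ((1 - C e) * (1 + C β * C e) - ((1 - C e) + (2 - C e) * (1 + C β * C e)) * U
        + (3 + (C β - 1) * C e) * D - T) =
      - T + (3 + (2 * C α + 3 + C β) * C e) * D - C e * (3 + (2 * C α + 2 + C β) * C e) * U := by
  have hn0 : (n : ℝ) ≠ 0 := by positivity
  have hne : C (n : ℝ) * C e = (1 : ℝ⟦X⟧) := by
    rw [← map_mul, he, mul_one_div_cancel hn0, map_one]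
  have hC0 : C (n : ℝ) ≠ (0 : ℝ⟦X⟧) := by
    intro h0; rw [h0, zero_mul] at hne; exact zero_ne_one hne
  have d2 : eulerOp (eulerOp Q) = C (n : ℝ) ^ 2 * D * Q := by
    rw [hU]; simp only [eulerOp_mul, eulerOp_C, hU]
    rw [hD]
    linear_combination (-C (n : ℝ) * eulerOp U * Q) * hne
  have d3 : eulerOp (eulerOp (eulerOp Q)) = C (n : ℝ) ^ 3 * T * Q := by
    have h1 : eulerOp Q = C (n : ℝ) * (U * Q) := by rw [hU]; ring
    rw [h1]; simp only [eulerOp_mul, eulerOp_C, hU, map_add, mul_zero, add_zero]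
    rw [hT]
    linear_combination (-3 * C (n : ℝ) ^ 2 * U * eulerOp U * Q
      - C (n : ℝ) * (C (n : ℝ) * C e + 1) * eulerOp (eulerOp U) * Q) * hne
  rw [d3, d2, hU] at hode
  have h2 : C (2 : ℝ) = (2 : ℝ⟦X⟧) := map_ofNat _ 2
  have h3 : C (3 : ℝ) = (3 : ℝ⟦X⟧) := map_ofNat _ 3
  simp only [map_mul, map_add, map_sub, map_one, h2, h3] at hode
  apply mul_left_cancel₀ (mul_ne_zero (pow_ne_zero 3 hC0) hQ0)
  generalize C (n : ℝ) = N at *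
  generalize C e = E at *
  generalize (C α : ℝ⟦X⟧) = a at *
  generalize (C β : ℝ⟦X⟧) = b at *
  have f1 : N ^ 3 * ((1 - E) * (1 + b * E)) = N * (N - 1) * (N + b) := by
    linear_combination (N ^ 2 * (b - 1) - b * N * (N * E + 1)) * hne
  have f2 : N ^ 3 * (1 - E + (2 - E) * (1 + b * E)) =
      (N * (N - 1) + (2 * N - 1) * (N + b)) * N := by
    linear_combination (N ^ 2 * (2 * b - 2) - b * N * (N * E + 1)) * hne
  have f3 : N ^ 3 * (3 + (b - 1) * E) = (3 * N - 1 + b) * N ^ 2 := by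
    linear_combination N ^ 2 * (b - 1) * hne
  have f4 : N ^ 3 * (3 + (2 * a + 3 + b) * E) = (3 * N + 2 * a + 3 + b) * N ^ 2 := by
    linear_combination N ^ 2 * (2 * a + 3 + b) * hne
  have f5 : N ^ 3 * (E * (3 + (2 * a + 2 + b) * E)) = (3 * N + 2 * a + 2 + b) * N := by
    linear_combination (3 * N ^ 2 + (2 * a + 2 + b) * N * (N * E + 1)) * hne
  linear_combination hode + X ^ 2 * Q * (f1 - U * f2 + D * f3) - Q * D * f4 + Q * U * f5

open Filter Topology MeasureTheory Set

/-- The generating series of the moments of the normalized counting measure of `x`. -/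
noncomputable def momentSeries (n : ℕ) (x : Fin n → ℝ) : ℝ⟦X⟧ :=
  mk fun m => 1 / (n : ℝ) * ∑ j, x j ^ m

theorem momentSeries_equation {n : ℕ} (hn : 1 ≤ n) {α β : ℝ} (hα : -1 < α) (hβ : -1 < β)
    {x : Fin n → ℝ} (hmem : ∀ j, x j ∈ Ioo (0 : ℝ) 1) (hzero : ∀ j, jacAng 2 n α β (x j) = 0)
    (hinj : Function.Injective x) {e : ℝ} (he : e = 1 / n) {U D T : ℝ⟦X⟧}
    (hU : U = 1 - momentSeries n x)
    (hD : D = U ^ 2 + C e * eulerOp U)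
    (hT : T = U ^ 3 + 3 * C e * U * eulerOp U + C e ^ 2 * eulerOp (eulerOp U)) :
    X ^ 2 * ((1 - C e) * (1 + C β * C e) - ((1 - C e) + (2 - C e) * (1 + C β * C e)) * U
        + (3 + (C β - 1) * C e) * D - T) =
      - T + (3 + (2 * C α + 3 + C β) * C e) * D - C e * (3 + (2 * C α + 2 + C β) * C e) * U := by
  have hprod := reversedSeries_eq_prod (fun j => (hmem j).1.ne') hinj
    (fun j => (jacAng_two_eq n α β (x j)).symm.trans (hzero j))
  have hc := jacCoeff_self_ne_zero hn hα hβ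
  have hn0 : (n : ℝ) ≠ 0 := by positivity
  refine log_derivative_equation hn (Q := reversedSeries n (jacCoeff n α β)) ?_ ?_
    (reversedSeries_jacCoeff_ode n hα hβ rfl) he hD hT
  · intro h0
    have := congrArg (coeff 0) h0
    simp [reversedSeries, hc] at this
  · have hsum : ∑ j, (1 - mk fun m => x j ^ m) = C (n : ℝ) * U := by
      ext m
      rw [hU, coeff_C_mul, map_sub, momentSeries, coeff_mk, mul_sub, ← mul_assoc,
        mul_one_div_cancel hn0]
      simp only [map_sum, map_sub, coeff_mk]
      rw [Finset.sum_sub_distrib]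
      simp
    rw [hprod, eulerOp_mul, eulerOp_C, eulerOp_prod_one_sub, hsum]
    ring

open scoped PowerSeries.WithPiTopology

theorem continuous_eulerOp : Continuous (eulerOp : ℝ⟦X⟧ → ℝ⟦X⟧) := by
  rw [continuous_iff_continuousAt]
  intro f
  refine (WithPiTopology.tendsto_iff_coeff_tendsto _ _ _ _).mpr fun m => ?_
  simp only [coeff_eulerOp]
  exact ((WithPiTopology.continuous_coeff ℝ m).tendsto f).const_mul _

theorem cubic_of_tendsto {α β : ℝ} (hα : -1 < α) (hβ : -1 < β) {x : (n : ℕ) → Fin n → ℝ}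
    (hmem : ∀ n, ∀ j : Fin n, x n j ∈ Ioo (0 : ℝ) 1)
    (hzero : ∀ n, ∀ j : Fin n, jacAng 2 n α β (x n j) = 0)
    (hinj : ∀ n, Function.Injective (x n)) {l : Filter ℕ} [l.NeBot] (hl : l ≤ atTop) {G : ℝ⟦X⟧}
    (hG : Tendsto (fun n => momentSeries n (x n)) l (𝓝 G)) :
    X ^ 2 * G ^ 3 = (1 - G) ^ 2 * (2 + G) := by
  have he : Tendsto (fun n : ℕ => (C (1 / (n : ℝ)) : ℝ⟦X⟧)) l (𝓝 0) := by
    have h0 : Tendsto (fun n : ℕ => 1 / (n : ℝ)) l (𝓝 0) :=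
      tendsto_one_div_atTop_nhds_zero_nat.mono_left hl
    have := ((WithPiTopology.continuous_C).tendsto (0 : ℝ)).comp h0
    rwa [map_zero] at this
  have hU : Tendsto (fun n => 1 - momentSeries n (x n)) l (𝓝 (1 - G)) := hG.const_sub 1
  have hU1 := (continuous_eulerOp.tendsto _).comp hU
  have hU2 := (continuous_eulerOp.tendsto _).comp hU1
  have hD := (hU.pow 2).add (he.mul hU1)
  have hT := ((hU.pow 3).add (((he.const_mul 3).mul hU).mul hU1)).add ((he.pow 2).mul hU2)
  have hE := (he.const_mul (C β)).const_add 1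
  have hL := (((((he.const_sub 1).mul hE).sub
      (((he.const_sub 1).add ((he.const_sub 2).mul hE)).mul hU)).add
      (((he.const_mul (C β - 1)).const_add 3).mul hD)).sub hT).const_mul (X ^ 2)
  have hR := (hT.neg.add (((he.const_mul (2 * C α + 3 + C β)).const_add 3).mul hD)).sub
    ((he.mul ((he.const_mul (2 * C α + 2 + C β)).const_add 3)).mul hU)
  have hLR := tendsto_nhds_unique (hL.congr' ?_) hR
  · linear_combination hLR
  · filter_upwards [hl (eventually_ge_atTop 1)] with n hn
    exact momentSeries_equation hn hα hβ (hmem n) (hzero n) (hinj n) rfl rfl rfl rfl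

theorem tendsto_moments {α β : ℝ} (hα : -1 < α) (hβ : -1 < β) {x : (n : ℕ) → Fin n → ℝ}
    (hmem : ∀ n, ∀ j : Fin n, x n j ∈ Ioo (0 : ℝ) 1)
    (hzero : ∀ n, ∀ j : Fin n, jacAng 2 n α β (x n j) = 0)
    (hinj : ∀ n, Function.Injective (x n)) {M : ℕ → ℝ} (hM0 : M 0 = 1) (hM1 : M 1 = 1 / √3)
    (hM : ∀ m : ℕ, 9 * ((m + 2 : ℝ) * (m + 1)) * M (m + 2) =
      (9 * (m : ℝ) ^ 2 + 18 * m + 8) * M m) (m : ℕ) :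
    Tendsto (fun n : ℕ => 1 / (n : ℝ) * ∑ j, x n j ^ m) atTop (𝓝 (M m)) := by
  have key : Tendsto (fun (n : ℕ) (m : ℕ) => 1 / (n : ℝ) * ∑ j, x n j ^ m) atTop (𝓝 M) := by
    refine IsCompact.tendsto_nhds_of_unique_mapClusterPt
      (isCompact_univ_pi fun _ : ℕ => isCompact_Icc (a := (0 : ℝ)) (b := 1)) ?_ ?_
    · filter_upwards [eventually_ge_atTop 1] with n hn m _
      have hn0 : (0 : ℝ) < n := by exact_mod_cast hn
      constructor
      · have := fun j => (hmem n j).1.le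
        exact mul_nonneg (by positivity) (Finset.sum_nonneg fun j _ => pow_nonneg (this j) m)
      · have : ∑ j, x n j ^ m ≤ n := by
          simpa using Finset.sum_le_card_nsmul Finset.univ (fun j => x n j ^ m) 1
            fun j _ => pow_le_one₀ (hmem n j).1.le (hmem n j).2.le
        show 1 / (n : ℝ) * ∑ j, x n j ^ m ≤ 1
        rw [one_div_mul_eq_div]
        exact (div_le_one hn0).mpr this
    · intro y hy hcl
      obtain ⟨V, hV, hVy⟩ := mapClusterPt_iff_ultrafilter.mp hcl
      rw [tendsto_pi_nhds] at hVy
      have hcub := cubic_of_tendsto hα hβ hmem hzero hinj hV (G := mk y)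
        ((WithPiTopology.tendsto_iff_coeff_tendsto _ _ _ _).mpr fun m => by
          simpa only [momentSeries, coeff_mk] using hVy m)
      have hy0 : y 0 = 1 := by
        refine tendsto_nhds_unique (hVy 0) (tendsto_const_nhds.congr' ?_)
        filter_upwards [hV (eventually_ge_atTop 1)] with n hn
        have hn0 : (n : ℝ) ≠ 0 := by positivity
        simp [hn0]
      have hc0 : coeff 0 (mk y) = 1 := by rw [coeff_mk, hy0]
      have hy1 : y 1 = 1 / √3 := by
        simpa only [coeff_mk] using coeff_one_of_cubic hcub hc0
          (by rw [coeff_mk]; exact (hy 1 (mem_univ _)).1)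
      have hrec := coeff_recurrence_of_cubic hcub hc0
      simp only [coeff_mk] at hrec
      funext m
      induction m using Nat.twoStepInduction with
      | zero => rw [hy0, hM0]
      | one => rw [hy1, hM1]
      | more k ih _ =>
        have h9 : (9 : ℝ) * ((k + 2 : ℝ) * (k + 1)) ≠ 0 := by positivity
        apply mul_left_cancel₀ h9
        rw [hrec, hM, ih]
  exact tendsto_pi_nhds.mp key m

theorem integral_rpow_mul_one_sub_rpow {a b : ℝ} (ha : 0 < a) (hb : 0 < b) :
    ∫ s in Ioo (0 : ℝ) 1, s ^ (a - 1) * (1 - s) ^ (b - 1) = ProbabilityTheory.beta a b := by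
  rw [ProbabilityTheory.beta_eq_betaIntegralReal a b ha hb, Complex.betaIntegral,
    intervalIntegral.integral_of_le (by norm_num), ← integral_Ioc_eq_integral_Ioo,
    ← RCLike.re_to_complex, ← integral_re]
  · refine setIntegral_congr_fun measurableSet_Ioc fun x ⟨hx1, hx₂⟩ ↦ ?_
    norm_cast
    rw [← Complex.ofReal_cpow, ← Complex.ofReal_cpow, RCLike.re_to_complex,
      Complex.re_mul_ofReal, Complex.ofReal_re]
    all_goals linarith
  have := Complex.betaIntegral_convergent (u := a) (v := b) (by simpa) (by simpa)
  rwa [intervalIntegrable_iff_integrableOn_Ioc_of_le (by simp), IntegrableOn] at this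

theorem image_two_mul_sqrt :
    (fun s : ℝ => 2 * √(s * (1 - s))) '' Ioo 0 (1 / 2) = Ioo 0 1 := by
  ext t
  constructor
  · rintro ⟨s, ⟨h0, h1⟩, rfl⟩
    have hp : 0 < s * (1 - s) := mul_pos h0 (by linarith)
    refine ⟨by positivity, ?_⟩
    have : √(s * (1 - s)) < 1 / 2 := by
      rw [Real.sqrt_lt' (by norm_num)]; nlinarith
    linarith
  · rintro ⟨h0, h1⟩
    have hp : 0 < 1 - t ^ 2 := by nlinarith
    have hs := Real.sq_sqrt hp.le
    have hs0 := Real.sqrt_pos.mpr hp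
    have hs1 : √(1 - t ^ 2) < 1 := by
      rw [Real.sqrt_lt' (by norm_num)]; nlinarith
    refine ⟨(1 - √(1 - t ^ 2)) / 2, ⟨by linarith, by linarith⟩, ?_⟩
    simp only
    rw [show (1 - √(1 - t ^ 2)) / 2 * (1 - (1 - √(1 - t ^ 2)) / 2) = (t / 2) ^ 2 by
      linear_combination (-1 / 4) * hs, Real.sqrt_sq (by linarith)]
    ring

theorem injOn_two_mul_sqrt : InjOn (fun s : ℝ => 2 * √(s * (1 - s))) (Ioo 0 (1 / 2)) := by
  rintro s ⟨h0, h1⟩ r ⟨g0, g1⟩ h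
  have h2 : √(s * (1 - s)) = √(r * (1 - r)) := by simpa using h
  rw [Real.sqrt_inj (by nlinarith) (by nlinarith)] at h2
  have : (s - r) * (1 - s - r) = 0 := by linear_combination h2
  rcases mul_eq_zero.mp this with h | h <;> linarith

theorem hasDerivAt_two_mul_sqrt {s : ℝ} (hs : s ∈ Ioo (0 : ℝ) (1 / 2)) :
    HasDerivAt (fun s : ℝ => 2 * √(s * (1 - s))) ((1 - 2 * s) / √(s * (1 - s))) s := by
  have hp : s * (1 - s) ≠ 0 := (mul_pos hs.1 (by linarith [hs.2])).ne'
  have h := (((hasDerivAt_id s).mul ((hasDerivAt_id s).const_sub 1)).sqrt hp).const_mul 2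
  convert! h using 1
  simp only [Pi.mul_apply, id]
  ring

/-- The pullback of `t ^ m * u2 t` under `t = 2 √(s (1 - s))` is a symmetrized beta density. -/
theorem deriv_mul_pow_mul_u2 (m : ℕ) {s : ℝ} (hs : s ∈ Ioo (0 : ℝ) (1 / 2)) :
    |(1 - 2 * s) / √(s * (1 - s))| *
      ((2 * √(s * (1 - s))) ^ m * u2 (2 * √(s * (1 - s)))) =
    √3 / (2 * Real.pi) * 2 ^ m *
      (s ^ ((m : ℝ) / 2 + 1 / 3 - 1) * (1 - s) ^ ((m : ℝ) / 2 + 2 / 3 - 1) +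
        (1 - s) ^ ((m : ℝ) / 2 + 1 / 3 - 1) * (1 - (1 - s)) ^ ((m : ℝ) / 2 + 2 / 3 - 1)) := by
  have h0 : 0 < s := hs.1
  have h1 : 0 < 1 - s := by linarith [hs.2]
  have h2 : 0 < 1 - 2 * s := by linarith [hs.2]
  have hp : 0 < s * (1 - s) := mul_pos h0 h1
  have sixth : ∀ {y : ℝ}, 0 < y → ∀ k : ℕ, (y ^ ((1 : ℝ) / 6)) ^ k = y ^ ((k : ℝ) / 6) := by
    intro y hy k
    rw [← Real.rpow_natCast, ← Real.rpow_mul hy.le]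
    congr 1; ring
  have third : ∀ {y : ℝ}, 0 < y → y ^ ((1 : ℝ) / 3) = (y ^ ((1 : ℝ) / 6)) ^ 2 := by
    intro y hy; rw [sixth hy]; norm_num
  have half : ∀ {y : ℝ}, 0 < y → √y = (y ^ ((1 : ℝ) / 6)) ^ 3 := by
    intro y hy; rw [sixth hy, Real.sqrt_eq_rpow]; norm_num
  have exp1 : ∀ {y : ℝ}, 0 < y → y ^ ((m : ℝ) / 2 + 1 / 3 - 1) =
      (y ^ ((1 : ℝ) / 6)) ^ (3 * m) / (y ^ ((1 : ℝ) / 6)) ^ 4 := by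
    intro y hy
    rw [sixth hy, sixth hy, ← Real.rpow_sub hy]
    congr 1; push_cast; ring
  have exp2 : ∀ {y : ℝ}, 0 < y → y ^ ((m : ℝ) / 2 + 2 / 3 - 1) =
      (y ^ ((1 : ℝ) / 6)) ^ (3 * m) / (y ^ ((1 : ℝ) / 6)) ^ 2 := by
    intro y hy
    rw [sixth hy, sixth hy, ← Real.rpow_sub hy]
    congr 1; push_cast; ring
  have hroot : √(1 - (2 * √(s * (1 - s))) ^ 2) = 1 - 2 * s := by
    rw [mul_pow, Real.sq_sqrt hp.le, show 1 - 2 ^ 2 * (s * (1 - s)) = (1 - 2 * s) ^ 2 by ring,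
      Real.sqrt_sq h2.le]
  have hsq : √(s * (1 - s)) = (s ^ ((1 : ℝ) / 6)) ^ 3 * ((1 - s) ^ ((1 : ℝ) / 6)) ^ 3 := by
    rw [Real.sqrt_mul h0.le, half h0, half h1]
  have hthird : (2 * √(s * (1 - s))) ^ ((1 : ℝ) / 3) =
      (2 : ℝ) ^ ((1 : ℝ) / 3) * (s ^ ((1 : ℝ) / 6) * (1 - s) ^ ((1 : ℝ) / 6)) := by
    rw [Real.mul_rpow (by norm_num) (Real.sqrt_nonneg _), Real.sqrt_eq_rpow, ← Real.rpow_mul hp.le,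
      ← Real.mul_rpow h0.le h1.le]
    norm_num
  rw [abs_of_pos (div_pos h2 (Real.sqrt_pos.mpr hp)), u2, hroot, hthird,
    show 1 + (1 - 2 * s) = 2 * (1 - s) by ring, show 1 - (1 - 2 * s) = 2 * s by ring,
    show 1 - (1 - s) = s by ring, Real.mul_rpow (by norm_num) h1.le,
    Real.mul_rpow (by norm_num) h0.le, exp1 h0, exp1 h1, exp2 h0, exp2 h1, third h0, third h1, hsq]
  have hA := Real.rpow_pos_of_pos h0 ((1 : ℝ) / 6)
  have hB := Real.rpow_pos_of_pos h1 ((1 : ℝ) / 6)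
  have hT := Real.rpow_pos_of_pos (show (0 : ℝ) < 2 by norm_num) ((1 : ℝ) / 3)
  generalize s ^ ((1 : ℝ) / 6) = A at *
  generalize (1 - s) ^ ((1 : ℝ) / 6) = B at *
  generalize (2 : ℝ) ^ ((1 : ℝ) / 3) = R at *
  rw [mul_pow, mul_pow, ← pow_mul, ← pow_mul]
  have hpi := Real.pi_pos
  generalize 1 - 2 * s = q at *
  field_simp

theorem integral_pow_mul_u2 (m : ℕ) :
    ∫ t in (0 : ℝ)..1, t ^ m * u2 t =
      √3 / (2 * Real.pi) * 2 ^ m * ProbabilityTheory.beta ((m : ℝ) / 2 + 1 / 3) (m / 2 + 2 / 3) := by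
  have ha : 0 < (m : ℝ) / 2 + 1 / 3 := by positivity
  have hb : 0 < (m : ℝ) / 2 + 2 / 3 := by positivity
  set w : ℝ → ℝ := fun s => s ^ ((m : ℝ) / 2 + 1 / 3 - 1) * (1 - s) ^ ((m : ℝ) / 2 + 2 / 3 - 1)
  have hbeta := integral_rpow_mul_one_sub_rpow ha hb
  have hint : IntegrableOn w (Ioo 0 1) :=
    Integrable.of_integral_ne_zero (by rw [hbeta]; exact (ProbabilityTheory.beta_pos ha hb).ne')
  have hI : IntervalIntegrable w volume 0 1 :=
    (intervalIntegrable_iff_integrableOn_Ioo_of_le zero_le_one).mpr hint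
  have hI1 : IntervalIntegrable w volume 0 (1 / 2) :=
    hI.mono_set (by rw [uIcc_of_le (by norm_num), uIcc_of_le (by norm_num)]; gcongr; norm_num)
  have hI2 : IntervalIntegrable w volume (1 / 2) 1 :=
    hI.mono_set (by rw [uIcc_of_le (by norm_num), uIcc_of_le (by norm_num)]; gcongr; norm_num)
  have hI3 : IntervalIntegrable (fun s => w (1 - s)) volume 0 (1 / 2) := by
    have := (hI2.comp_sub_left 1).symm
    norm_num at this
    exact this
  rw [intervalIntegral.integral_of_le zero_le_one, integral_Ioc_eq_integral_Ioo,
    ← image_two_mul_sqrt, integral_image_eq_integral_abs_deriv_smul measurableSet_Ioo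
      (fun s hs => (hasDerivAt_two_mul_sqrt hs).hasDerivWithinAt) injOn_two_mul_sqrt,
    setIntegral_congr_fun (f := fun s => |(1 - 2 * s) / √(s * (1 - s))| •
      ((2 * √(s * (1 - s))) ^ m * u2 (2 * √(s * (1 - s)))))
      (g := fun s => √3 / (2 * Real.pi) * 2 ^ m * (w s + w (1 - s))) measurableSet_Ioo
      (fun s hs => deriv_mul_pow_mul_u2 m hs),
    integral_const_mul, ← hbeta, ← integral_Ioc_eq_integral_Ioo, ← integral_Ioc_eq_integral_Ioo,
    ← intervalIntegral.integral_of_le (by norm_num), ← intervalIntegral.integral_of_le (by norm_num),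
    intervalIntegral.integral_add hI1 hI3, intervalIntegral.integral_comp_sub_left w 1]
  congr 1
  rw [← intervalIntegral.integral_add_adjacent_intervals hI1 hI2]
  norm_num

theorem integral_u2 : ∫ t in (0 : ℝ)..1, u2 t = 1 := by
  have h := integral_pow_mul_u2 0
  have hg := Real.Gamma_mul_Gamma_one_sub (1 / 3)
  rw [show Real.pi * (1 / 3) = Real.pi / 3 by ring, Real.sin_pi_div_three] at hg
  norm_num [ProbabilityTheory.beta] at h hg
  rw [h, hg]
  have := Real.pi_pos
  field_simp

theorem integral_id_mul_u2 : ∫ t in (0 : ℝ)..1, t * u2 t = 1 / √3 := by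
  have h := integral_pow_mul_u2 1
  have hg := Real.Gamma_mul_Gamma_one_sub (1 / 6)
  have hg1 := Real.Gamma_add_one (s := 1 / 6) (by norm_num)
  rw [show Real.pi * (1 / 6) = Real.pi / 6 by ring, Real.sin_pi_div_six] at hg
  norm_num [ProbabilityTheory.beta] at h hg hg1
  rw [h, hg1, show Real.Gamma (5 / 6) * (1 / 6 * Real.Gamma (1 / 6)) =
    1 / 6 * (Real.Gamma (1 / 6) * Real.Gamma (5 / 6)) by ring, hg]
  have := Real.pi_pos
  have h3 := Real.sq_sqrt (show (0 : ℝ) ≤ 3 by norm_num)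
  field_simp
  linear_combination 2 * h3

theorem integral_pow_mul_u2_recurrence (m : ℕ) :
    9 * ((m + 2 : ℝ) * (m + 1)) * ∫ t in (0 : ℝ)..1, t ^ (m + 2) * u2 t =
      (9 * (m : ℝ) ^ 2 + 18 * m + 8) * ∫ t in (0 : ℝ)..1, t ^ m * u2 t := by
  rw [integral_pow_mul_u2, integral_pow_mul_u2]
  have ha : 0 < (m : ℝ) / 2 + 1 / 3 := by positivity
  have hb : 0 < (m : ℝ) / 2 + 2 / 3 := by positivity
  have hm : 0 < (m : ℝ) + 1 := by positivity
  have hm2 : 0 < (m : ℝ) + 2 := by positivity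
  have g := Real.Gamma_pos_of_pos hm
  simp only [ProbabilityTheory.beta]
  push_cast
  rw [show ((m : ℝ) + 2) / 2 + 1 / 3 = m / 2 + 1 / 3 + 1 by ring,
    show ((m : ℝ) + 2) / 2 + 2 / 3 = m / 2 + 2 / 3 + 1 by ring,
    show (m : ℝ) / 2 + 1 / 3 + 1 + (m / 2 + 2 / 3 + 1) = m + 1 + 1 + 1 by ring,
    show (m : ℝ) / 2 + 1 / 3 + (m / 2 + 2 / 3) = m + 1 by ring,
    Real.Gamma_add_one ha.ne', Real.Gamma_add_one hb.ne',
    Real.Gamma_add_one (show (m : ℝ) + 1 + 1 ≠ 0 by positivity), Real.Gamma_add_one hm.ne',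
    show (m : ℝ) + 1 + 1 = m + 2 by ring]
  generalize Real.Gamma ((m : ℝ) / 2 + 1 / 3) = A
  generalize Real.Gamma ((m : ℝ) / 2 + 2 / 3) = B
  generalize Real.Gamma ((m : ℝ) + 1) = D at *
  have hpi := Real.pi_pos
  field_simp
  ring

theorem u2_nonneg {t : ℝ} (ht : t ∈ Ioo (0 : ℝ) 1) : 0 ≤ u2 t := by
  have h1 : √(1 - t ^ 2) ≤ 1 := Real.sqrt_le_one.mpr (by nlinarith [sq_nonneg t])
  have h2 : 0 ≤ (1 - √(1 - t ^ 2)) ^ ((1 : ℝ) / 3) := Real.rpow_nonneg (by linarith) _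
  have h3 : 0 ≤ t := ht.1.le
  have := Real.pi_pos
  unfold u2
  positivity

theorem intervalIntegrable_u2 : IntervalIntegrable u2 volume 0 1 := by
  by_contra h
  have := intervalIntegral.integral_undef h
  rw [integral_u2] at this
  exact one_ne_zero this

/-- Convergence of all power moments to those of `u2` implies weak convergence. -/
theorem tendsto_mean_of_tendsto_moments {x : (n : ℕ) → Fin n → ℝ}
    (hmem : ∀ n, ∀ j : Fin n, x n j ∈ Ioo (0 : ℝ) 1)
    (hmom : ∀ m : ℕ, Tendsto (fun n : ℕ => 1 / (n : ℝ) * ∑ j, x n j ^ m) atTop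
      (𝓝 (∫ t in (0 : ℝ)..1, t ^ m * u2 t)))
    {f : ℝ → ℝ} (hf : ContinuousOn f (Icc 0 1)) :
    Tendsto (fun n : ℕ => 1 / (n : ℝ) * ∑ j, f (x n j)) atTop
      (𝓝 (∫ t in (0 : ℝ)..1, f t * u2 t)) := by
  have hint : ∀ {g : ℝ → ℝ}, ContinuousOn g (Icc 0 1) →
      IntervalIntegrable (fun t => g t * u2 t) volume 0 1 := fun hg =>
    intervalIntegrable_u2.continuousOn_mul (by rwa [uIcc_of_le zero_le_one])
  have hpoly : ∀ p : Polynomial ℝ, Tendsto (fun n : ℕ => 1 / (n : ℝ) * ∑ j, p.eval (x n j)) atTop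
      (𝓝 (∫ t in (0 : ℝ)..1, p.eval t * u2 t)) := by
    intro p
    induction p using Polynomial.induction_on' with
    | add p q hp hq =>
      have h := hp.add hq
      rw [← intervalIntegral.integral_add (hint p.continuousOn) (hint q.continuousOn)] at h
      simpa only [Polynomial.eval_add, Finset.sum_add_distrib, mul_add, add_mul] using h
    | monomial m a =>
      have h := (hmom m).const_mul a
      rw [← intervalIntegral.integral_const_mul] at h
      simpa only [Polynomial.eval_monomial, Finset.mul_sum, mul_left_comm, mul_assoc] using h
  rw [Metric.tendsto_atTop]
  intro ε hε
  obtain ⟨p, hp⟩ := exists_polynomial_near_of_continuousOn 0 1 f hf (ε / 3) (by positivity)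
  obtain ⟨N, hN⟩ := Metric.tendsto_atTop.mp (hpoly p) (ε / 3) (by positivity)
  refine ⟨max N 1, fun n hn => ?_⟩
  have hn0 : (0 : ℝ) < n := by exact_mod_cast (le_max_right N 1).trans hn
  have h1 := hN n ((le_max_left N 1).trans hn)
  have h2 : |1 / (n : ℝ) * ∑ j, p.eval (x n j) - 1 / (n : ℝ) * ∑ j, f (x n j)| ≤ ε / 3 := by
    rw [← mul_sub, ← Finset.sum_sub_distrib, abs_mul, abs_of_pos (by positivity),
      one_div_mul_eq_div, div_le_iff₀ hn0]
    refine (Finset.abs_sum_le_sum_abs _ _).trans ?_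
    have := Finset.sum_le_card_nsmul Finset.univ (fun j => |p.eval (x n j) - f (x n j)|) (ε / 3)
      fun j _ => (hp _ (Ioo_subset_Icc_self (hmem n j))).le
    simpa [mul_comm] using this
  have h3 : |(∫ t in (0 : ℝ)..1, p.eval t * u2 t) - ∫ t in (0 : ℝ)..1, f t * u2 t| ≤ ε / 3 := by
    rw [← intervalIntegral.integral_sub (hint p.continuousOn) (hint hf)]
    have hb := intervalIntegral.norm_integral_le_of_norm_le (μ := volume) (zero_le_one (α := ℝ))
      (f := fun t => p.eval t * u2 t - f t * u2 t) (g := fun t => ε / 3 * u2 t) ?_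
      (intervalIntegrable_u2.const_mul _)
    · rwa [intervalIntegral.integral_const_mul, integral_u2, mul_one] at hb
    · have h1 : ∀ᵐ t : ℝ, t ≠ 1 := by simp [ae_iff]
      filter_upwards [h1] with t ht1 ht
      have hu := u2_nonneg ⟨ht.1, lt_of_le_of_ne ht.2 ht1⟩
      rw [← sub_mul, norm_mul, Real.norm_of_nonneg hu]
      exact mul_le_mul_of_nonneg_right (hp t ⟨ht.1.le, ht.2⟩).le hu
  rw [Real.dist_eq] at h1 ⊢
  rw [abs_lt] at h1 ⊢
  rw [abs_le] at h2 h3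
  constructor <;> linarith

end

/-- the asymptotic zero distribution of p_n(x; α, β) (r = 2) has density u_2 on
[0,1], independently of α and β: for any family (x_{j,n})_{j=1..n} of n distinct zeros of
p_n in (0,1), and every continuous f on [0,1],
(1/n) ∑_j f(x_{j,n}) → ∫_0^1 f(x) u_2(x) dx. -/
theorem jacAng_asymptotic_zero_distribution_r_two
    (α β : ℝ) (hα : -1 < α) (hβ : -1 < β)
    (x : (n : ℕ) → Fin n → ℝ)
    (hmem : ∀ n, ∀ j : Fin n, x n j ∈ Set.Ioo (0:ℝ) 1)
    (hzero : ∀ n, ∀ j : Fin n, jacAng 2 n α β (x n j) = 0)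
    (hinj : ∀ n, Function.Injective (x n)) :
    ∀ f : ℝ → ℝ, ContinuousOn f (Set.Icc 0 1) →
      Filter.Tendsto (fun n : ℕ => (1 / (n : ℝ)) * ∑ j : Fin n, f (x n j))
        Filter.atTop (nhds (∫ t in (0:ℝ)..1, f t * u2 t)) := by
  intro f hf
  exact tendsto_mean_of_tendsto_moments hmem (fun m => tendsto_moments hα hβ hmem hzero hinj
    (M := fun m => ∫ t in (0 : ℝ)..1, t ^ m * u2 t) (by simpa using integral_u2)
    (by simpa using integral_id_mul_u2) integral_pow_mul_u2_recurrence m) hf
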